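/- Let M : ℝˡ × ℝⁿ ⇒ ℝᵐ have closed graph and 0 ∈ M(p̄, x̄). Assume there do not exist u ∈ ℝⁿ with ‖u‖ = 1 and q ∈ ℝˡ with ‖q‖ = 1 and q ∈ T_{dom H_M}(p̄) satisfying 0 ∈ DM(p̄,x̄,0)(0,u) and (−q, 0) ∈ D*_{>p}M((p̄,x̄,0); u)(0). Then M has the restricted calmness property with respect to p at (p̄, x̄, 0). -/

import Mathlib

open Filter Topology Metric Set
open scoped RealInnerProductSpace

noncomputable section

abbrev Es (k : ℕ) : Type := EuclideanSpace ℝ (Fin k)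

/-- The tangent (contingent) cone to `A` at `x`. -/
def tcone {E : Type*} [NormedAddCommGroup E] [NormedSpace ℝ E] (A : Set E) (x : E) : Set E :=
  {w | ∃ t : ℕ → ℝ, ∃ w' : ℕ → E,
    (∀ k, 0 < t k) ∧ Tendsto t atTop (𝓝 0) ∧ Tendsto w' atTop (𝓝 w) ∧
    ∀ k, x + t k • w' k ∈ A}

/-- Graph of a multifunction of two variables, as a subset of a triple product. -/
def gph3 {P X Y : Type*} (M : P × X → Set Y) : Set (P × X × Y) :=
  {z | z.2.2 ∈ M (z.1, z.2.1)}

/-- The canonical pairing on a triple product of real inner product spaces. -/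
def pr3 {P X Y : Type*} [NormedAddCommGroup P] [InnerProductSpace ℝ P]
    [NormedAddCommGroup X] [InnerProductSpace ℝ X]
    [NormedAddCommGroup Y] [InnerProductSpace ℝ Y] (a b : P × X × Y) : ℝ :=
  ⟪a.1, b.1⟫ + ⟪a.2.1, b.2.1⟫ + ⟪a.2.2, b.2.2⟫

/-- The regular (Fréchet) normal cone to `A ⊆ P × X × Y` at `z`; it is empty
(by convention) when `z ∉ A`. -/
def rnc3 {P X Y : Type*} [NormedAddCommGroup P] [InnerProductSpace ℝ P]
    [NormedAddCommGroup X] [InnerProductSpace ℝ X]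
    [NormedAddCommGroup Y] [InnerProductSpace ℝ Y]
    (A : Set (P × X × Y)) (z : P × X × Y) : Set (P × X × Y) :=
  {zs | z ∈ A ∧ ∀ w ∈ tcone A z, pr3 zs w ≤ 0}

/-- The directional limiting normal cone to `A ⊆ P × X × Y` at `z` in direction `w`. -/
def dnc3 {P X Y : Type*} [NormedAddCommGroup P] [InnerProductSpace ℝ P]
    [NormedAddCommGroup X] [InnerProductSpace ℝ X]
    [NormedAddCommGroup Y] [InnerProductSpace ℝ Y]
    (A : Set (P × X × Y)) (z w : P × X × Y) : Set (P × X × Y) :=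
  {zs | ∃ t : ℕ → ℝ, ∃ w' : ℕ → P × X × Y, ∃ zs' : ℕ → P × X × Y,
    (∀ k, 0 < t k) ∧ Tendsto t atTop (𝓝 0) ∧ Tendsto w' atTop (𝓝 w) ∧
    Tendsto zs' atTop (𝓝 zs) ∧ ∀ k, zs' k ∈ rnc3 A (z + t k • w' k)}

/-- The ℓ² distance on the product of two metric spaces. -/
def dist2 {X Y : Type*} [MetricSpace X] [MetricSpace Y] (a b : X × Y) : ℝ :=
  Real.sqrt (dist a.1 b.1 ^ 2 + dist a.2 b.2 ^ 2)

/-- Distance from a point to a set with respect to the ℓ² product metric. -/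
def infDist2 {X Y : Type*} [MetricSpace X] [MetricSpace Y] (a : X × Y) (B : Set (X × Y)) : ℝ :=
  sInf (dist2 a '' B)

/-- `M : P × X ⇒ Y` has the restricted calmness property with respect to `p` at
`(pb, xb, yb)`, the distance in `X × Y` being the ℓ² product metric. -/
def RestrCalm {P X Y : Type*} [MetricSpace P] [MetricSpace X] [MetricSpace Y]
    (M : P × X → Set Y) (pb : P) (xb : X) (yb : Y) : Prop :=
  ∃ L : ℝ, 0 ≤ L ∧ ∃ ε : ℝ, 0 < ε ∧ ∀ p x, dist p pb < ε → dist x xb < ε → yb ∈ M (p, x) →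
    infDist2 (x, yb) {z : X × Y | z.2 ∈ M (pb, z.1)} ≤ L * dist p pb

/-- The outer coderivative of `M` with respect to `p` in direction `u` at `(pb, xb, 0)`:
`(qs, us) ∈ dOuter M pb xb u vs` iff there are sequences `t k ↓ 0`,
`(q k, uk k, v k) → (0, u, 0)` with `q k ≠ 0` and regular normals
`(qsk k, usk k, -vsk k)` at `(pb + t k • q k, xb + t k • uk k, t k • v k)` converging to
`(qs, us, vs)`. -/
def dOuter {l n m : ℕ} (M : Es l × Es n → Set (Es m)) (pb : Es l) (xb : Es n)
    (u : Es n) (vs : Es m) : Set (Es l × Es n) :=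
  {qu | ∃ (t : ℕ → ℝ) (q : ℕ → Es l) (uk : ℕ → Es n) (v : ℕ → Es m)
      (qsk : ℕ → Es l) (usk : ℕ → Es n) (vsk : ℕ → Es m),
    (∀ k, 0 < t k) ∧ Tendsto t atTop (𝓝 0) ∧
    Tendsto q atTop (𝓝 0) ∧ Tendsto uk atTop (𝓝 u) ∧ Tendsto v atTop (𝓝 0) ∧
    (∀ k, q k ≠ 0) ∧
    Tendsto qsk atTop (𝓝 qu.1) ∧ Tendsto usk atTop (𝓝 qu.2) ∧ Tendsto vsk atTop (𝓝 vs) ∧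
    ∀ k, (qsk k, usk k, -vsk k) ∈
      rnc3 (gph3 M) (pb + t k • q k, xb + t k • uk k, t k • v k)}

theorem IsMinOn.hasFDerivAt_nonneg_of_mem_tcone {E : Type*} [NormedAddCommGroup E]
    [NormedSpace ℝ E] {A : Set E} {f : E → ℝ} {f' : E →L[ℝ] ℝ} {z w : E} (hmin : IsMinOn f A z)
    (hf : HasFDerivAt f f' z) (hw : w ∈ tcone A z) : 0 ≤ f' w := by
  obtain ⟨t, w', ht, ht0, hw', hA⟩ := hw
  have hlim : Tendsto (fun k => (t k)⁻¹ • (f (z + t k • w' k) - f z)) atTop (𝓝 (f' w)) := by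
    refine (hasFDerivWithinAt_univ.2 hf).lim ?_ (.of_forall fun _ => mem_univ _) ?_
    · simpa using ht0.smul hw'
    · exact hw'.congr fun k => (inv_smul_smul₀ (ht k).ne' _).symm
  refine ge_of_tendsto' hlim fun k => ?_
  have := hmin (hA k)
  exact mul_nonneg (inv_nonneg.2 (ht k).le) (sub_nonneg.2 this)

theorem hasFDerivAt_norm_of_ne_zero {E : Type*} [NormedAddCommGroup E] [InnerProductSpace ℝ E]
    {x : E} (hx : x ≠ 0) : HasFDerivAt (fun y : E => ‖y‖) (‖x‖⁻¹ • innerSL ℝ x) x := by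
  have hx' : ‖x‖ ≠ 0 := norm_ne_zero_iff.2 hx
  have h := (hasStrictFDerivAt_norm_sq x).hasFDerivAt.sqrt (pow_ne_zero 2 hx')
  simp only [Real.sqrt_sq (norm_nonneg _)] at h
  convert! h using 1
  ext y
  simp
  field_simp

section Penalty

variable {P X Y : Type*} [NormedAddCommGroup P] [NormedAddCommGroup X] [NormedAddCommGroup Y]

/-- The distance of the first component to `pb`, plus a quadratic penalty centred at `(x, 0)`. -/
def penalty (pb : P) (x : X) (c : ℝ) (z : P × X × Y) : ℝ :=
  ‖z.1 - pb‖ + c * (‖z.2.1 - x‖ ^ 2 + ‖z.2.2‖ ^ 2)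

theorem continuous_penalty (pb : P) (x : X) (c : ℝ) :
    Continuous (penalty pb x c : P × X × Y → ℝ) := by
  unfold penalty
  fun_prop

theorem mem_rnc3_of_isMinOn_penalty [InnerProductSpace ℝ P] [InnerProductSpace ℝ X]
    [InnerProductSpace ℝ Y] {A : Set (P × X × Y)} {pb p : P} {x x' : X} {y : Y} {c : ℝ}
    (hz : (p, x', y) ∈ A) (hp : p ≠ pb) (hmin : IsMinOn (penalty pb x c) A (p, x', y)) :
    (-(‖p - pb‖⁻¹ • (p - pb)), -((2 * c) • (x' - x)), -((2 * c) • y)) ∈ rnc3 A (p, x', y) := by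
  refine ⟨hz, fun w hw => ?_⟩
  have h1 : HasFDerivAt (fun z : P × X × Y => z.1 - pb) _ (p, x', y) :=
    (hasFDerivAt_fst (𝕜 := ℝ) (p := (p, x', y))).sub_const pb
  have hsnd := hasFDerivAt_snd (𝕜 := ℝ) (p := (p, x', y))
  have h2 : HasFDerivAt (fun z : P × X × Y => z.2.1 - x) _ (p, x', y) :=
    hsnd.fst.sub_const x
  have h3 : HasFDerivAt (fun z : P × X × Y => z.2.2) _ (p, x', y) :=
    hsnd.snd
  have h4 := HasFDerivAt.comp (p, x', y)
    (hasFDerivAt_norm_of_ne_zero (x := p - pb) (sub_ne_zero.2 hp)) h1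
  have h := hmin.hasFDerivAt_nonneg_of_mem_tcone
    (h4.add ((h2.norm_sq.add h3.norm_sq).const_mul c)) hw
  simp at h
  simp only [pr3, inner_neg_left, real_inner_smul_left, inner_sub_left]
  linarith

theorem IsClosed.exists_isMinOn_penalty [ProperSpace P] [ProperSpace X] [ProperSpace Y]
    {A : Set (P × X × Y)} (hA : IsClosed A) (hne : A.Nonempty) (pb : P) (x : X) {c : ℝ}
    (hc : 0 < c) : ∃ z ∈ A, IsMinOn (penalty pb x c) A z := by
  obtain ⟨z₀, hz₀⟩ := hne
  set δ := penalty pb x c z₀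
  have hK : IsCompact (A ∩ {z | penalty pb x c z ≤ δ}) := by
    have hS : IsClosed {z : P × X × Y | penalty pb x c z ≤ δ} :=
      _root_.isClosed_le (continuous_penalty pb x c) continuous_const
    refine Metric.isCompact_of_isClosed_isBounded (hA.inter hS) ?_
    have hb : Bornology.IsBounded
        (closedBall pb δ ×ˢ closedBall x √(δ / c) ×ˢ closedBall (0 : Y) √(δ / c)) :=
      isBounded_closedBall.prod (isBounded_closedBall.prod isBounded_closedBall)
    refine hb.subset ?_
    rintro ⟨p, x', y⟩ ⟨-, h⟩
    simp only [mem_ofPred_eq, penalty] at h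
    have e1 := mul_nonneg hc.le (sq_nonneg ‖x' - x‖)
    have e2 := mul_nonneg hc.le (sq_nonneg ‖y‖)
    have e3 := norm_nonneg (p - pb)
    refine ⟨?_, ?_, ?_⟩
    · rw [mem_closedBall, dist_eq_norm]; nlinarith
    · rw [mem_closedBall, dist_eq_norm]
      exact Real.le_sqrt_of_sq_le ((le_div_iff₀ hc).2 (by nlinarith))
    · rw [mem_closedBall, dist_zero_right]
      exact Real.le_sqrt_of_sq_le ((le_div_iff₀ hc).2 (by nlinarith))
  obtain ⟨z, ⟨hzA, hzδ⟩, hz⟩ :=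
    hK.exists_isMinOn ⟨z₀, hz₀, le_refl δ⟩ (continuous_penalty pb x c).continuousOn
  refine ⟨z, hzA, fun z' hz' => ?_⟩
  rcases le_total (penalty pb x c z') δ with h | h
  · exact hz ⟨hz', h⟩
  · exact hzδ.trans h

end Penalty

theorem infDist2_le_dist2 {X Y : Type*} [MetricSpace X] [MetricSpace Y] {a b : X × Y}
    {B : Set (X × Y)} (hb : b ∈ B) : infDist2 a B ≤ dist2 a b :=
  csInf_le ⟨0, by rintro _ ⟨z, -, rfl⟩; exact Real.sqrt_nonneg _⟩ ⟨b, hb, rfl⟩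

/-- A violation of the calmness estimate with constant `K` produces a nearby point of the graph
and a regular normal there which is almost of the form `(-b, 0, 0)` with `‖b‖ = 1`. -/
theorem exists_mem_rnc3_of_lt_infDist2 {l n m : ℕ} {M : Es l × Es n → Set (Es m)} {pb p : Es l}
    {xb x : Es n} (hcl : IsClosed (gph3 M)) (hbar : (0 : Es m) ∈ M (pb, xb)) {K : ℝ} (hK : 1 ≤ K)
    (hx : ‖x - xb‖ < 1 / K) (hM : (0 : Es m) ∈ M (p, x))
    (hd : K * ‖p - pb‖ < infDist2 (x, (0 : Es m)) {z : Es n × Es m | z.2 ∈ M (pb, z.1)}) :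
    ∃ (t : ℝ) (a u us : Es n) (b q : Es l) (v vs : Es m), 0 < t ∧ t < 1 / K ∧ ‖a‖ = 1 ∧ ‖b‖ = 1 ∧
      K * ‖q‖ ≤ 1 ∧ K * ‖u - a‖ ^ 2 ≤ 1 ∧ K * ‖v‖ ^ 2 ≤ 1 ∧ K * ‖us‖ ^ 2 ≤ 4 ∧
      K * ‖vs‖ ^ 2 ≤ 4 ∧ q = ‖q‖ • b ∧ q ≠ 0 ∧
      (-b, us, -vs) ∈ rnc3 (gph3 M) (pb + t • q, xb + t • u, t • v) := by
  set d := infDist2 (x, (0 : Es m)) {z : Es n × Es m | z.2 ∈ M (pb, z.1)} with hddef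
  have hK0 : 0 < K := by linarith
  have hδ := norm_nonneg (p - pb)
  have hd0 : 0 < d := by nlinarith
  have hdt : d ≤ ‖x - xb‖ := by
    have h := infDist2_le_dist2 (a := (x, (0 : Es m))) (b := (xb, 0))
      (B := {z : Es n × Es m | z.2 ∈ M (pb, z.1)}) hbar
    simpa [dist2, Real.sqrt_sq, dist_eq_norm] using h
  set t := ‖x - xb‖ with htdef
  have ht : 0 < t := hd0.trans_le hdt
  obtain ⟨⟨p', x', y⟩, hz, hmin⟩ :=
    hcl.exists_isMinOn_penalty ⟨(p, x, 0), hM⟩ pb x (inv_pos.2 hd0)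
  have hval : penalty pb x d⁻¹ (p', x', y) ≤ penalty pb x d⁻¹ (p, x, (0 : Es m)) := hmin hM
  simp only [penalty, sub_self, norm_zero, ne_eq, OfNat.ofNat_ne_zero, not_false_eq_true,
    zero_pow, add_zero, mul_zero] at hval
  set r := ‖x' - x‖ ^ 2 + ‖y‖ ^ 2 with hr
  have hr0 : 0 ≤ d⁻¹ * r := by positivity
  have hp'δ : ‖p' - pb‖ ≤ ‖p - pb‖ := by linarith
  have hrd : r ≤ ‖p - pb‖ * d := by
    have h : d⁻¹ * r ≤ ‖p - pb‖ := by linarith [norm_nonneg (p' - pb)]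
    rwa [inv_mul_le_iff₀ hd0, mul_comm] at h
  have hKr : K * r < d ^ 2 := by nlinarith
  have hx'r : K * ‖x' - x‖ ^ 2 ≤ d ^ 2 := by nlinarith [sq_nonneg ‖y‖]
  have hyr : K * ‖y‖ ^ 2 ≤ d ^ 2 := by nlinarith [sq_nonneg ‖x' - x‖]
  have hdt2 : d ^ 2 ≤ t ^ 2 := by gcongr
  have hp' : p' ≠ pb := by
    rintro rfl
    have h := infDist2_le_dist2 (a := (x, (0 : Es m))) (b := (x', y))
      (B := {z : Es n × Es m | z.2 ∈ M (p', z.1)}) hz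
    rw [← hddef, dist2, Real.le_sqrt' hd0] at h
    simp only [dist_comm x x', dist_eq_norm, zero_sub, norm_neg, ← hr] at h
    nlinarith
  have hpn : 0 < ‖p' - pb‖ := norm_pos_iff.2 (sub_ne_zero.2 hp')
  have hsc : ∀ {j : ℕ} (s : ℝ) (w : Es j), ‖s • w‖ ^ 2 = s ^ 2 * ‖w‖ ^ 2 := fun s w => by
    rw [norm_smul, mul_pow, Real.norm_eq_abs, sq_abs]
  refine ⟨t, t⁻¹ • (x - xb), t⁻¹ • (x' - xb), -((2 * d⁻¹) • (x' - x)),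
    ‖p' - pb‖⁻¹ • (p' - pb), t⁻¹ • (p' - pb), t⁻¹ • y, (2 * d⁻¹) • y, ht, hx, ?_, ?_, ?_, ?_,
    ?_, ?_, ?_, ?_, ?_, ?_⟩
  · rw [norm_smul, norm_inv, norm_norm, ← htdef, inv_mul_cancel₀ ht.ne']
  · rw [norm_smul, norm_inv, norm_norm, inv_mul_cancel₀ hpn.ne']
  · rw [norm_smul, norm_inv, Real.norm_of_nonneg ht.le, mul_left_comm, inv_mul_le_iff₀ ht]
    nlinarith
  · rw [← smul_sub, sub_sub_sub_cancel_right, hsc, inv_pow, mul_left_comm,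
      inv_mul_le_iff₀ (by positivity)]
    linarith
  · rw [hsc, inv_pow, mul_left_comm, inv_mul_le_iff₀ (by positivity)]
    linarith
  · rw [norm_neg, hsc, mul_pow, inv_pow, mul_left_comm, mul_assoc, inv_mul_eq_div]
    have := (div_le_one (by positivity)).2 hx'r
    linarith
  · rw [hsc, mul_pow, inv_pow, mul_left_comm, mul_assoc, inv_mul_eq_div]
    have := (div_le_one (by positivity)).2 hyr
    linarith
  · rw [norm_smul, norm_inv, Real.norm_of_nonneg ht.le, smul_smul, mul_assoc,
      mul_inv_cancel₀ hpn.ne', mul_one]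
  · exact smul_ne_zero (inv_ne_zero ht.ne') (sub_ne_zero.2 hp')
  · simp only [smul_inv_smul₀ ht.ne', add_sub_cancel]
    exact mem_rnc3_of_isMinOn_penalty hz hp' hmin

theorem tendsto_zero_of_natCast_mul_norm_sq_le {E : Type*} [NormedAddCommGroup E] {f : ℕ → E}
    {C : ℝ} (h : ∀ k : ℕ, ((k : ℝ) + 1) * ‖f k‖ ^ 2 ≤ C) : Tendsto f atTop (𝓝 0) := by
  have h1 : Tendsto (fun k : ℕ => C * (1 / ((k : ℝ) + 1))) atTop (𝓝 0) := by
    simpa using tendsto_one_div_add_atTop_nhds_zero_nat.const_mul C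
  have h2 : Tendsto (fun k => ‖f k‖ ^ 2) atTop (𝓝 0) :=
    squeeze_zero (fun k => sq_nonneg _)
      (fun k => by rw [mul_one_div, le_div_iff₀ (by positivity), mul_comm]; exact h k) h1
  rw [tendsto_zero_iff_norm_tendsto_zero]
  simpa [Real.sqrt_sq] using h2.sqrt

/-- Point-based sufficient condition for the restricted calmness property with respect
to `p` (Corollary `CorPropC`). -/
theorem stmt4 {l n m : ℕ} (M : Es l × Es n → Set (Es m)) (pb : Es l) (xb : Es n)
    (hcl : IsClosed (gph3 M)) (hbar : (0 : Es m) ∈ M (pb, xb))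
    (hyp : ¬ ∃ (u : Es n) (q : Es l), ‖u‖ = 1 ∧ ‖q‖ = 1 ∧
      q ∈ tcone {p : Es l | ∃ z : Es n × Es m, z.2 ∈ M (p, z.1)} pb ∧
      ((0 : Es l), u, (0 : Es m)) ∈ tcone (gph3 M) (pb, xb, (0 : Es m)) ∧
      (-q, (0 : Es n)) ∈ dOuter M pb xb u 0) :
    RestrCalm M pb xb 0 := by
  by_contra hcalm
  have hbad : ∀ k : ℕ, ∃ (t : ℝ) (a u us : Es n) (b q : Es l) (v vs : Es m), 0 < t ∧
      t < 1 / ((k : ℝ) + 1) ∧ ‖a‖ = 1 ∧ ‖b‖ = 1 ∧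
      ((k : ℝ) + 1) * ‖q‖ ≤ 1 ∧ ((k : ℝ) + 1) * ‖u - a‖ ^ 2 ≤ 1 ∧ ((k : ℝ) + 1) * ‖v‖ ^ 2 ≤ 1 ∧
      ((k : ℝ) + 1) * ‖us‖ ^ 2 ≤ 4 ∧ ((k : ℝ) + 1) * ‖vs‖ ^ 2 ≤ 4 ∧ q = ‖q‖ • b ∧ q ≠ 0 ∧
      (-b, us, -vs) ∈ rnc3 (gph3 M) (pb + t • q, xb + t • u, t • v) := by
    intro k
    have hk : (0 : ℝ) < (k : ℝ) + 1 := by positivity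
    by_contra hno
    refine hcalm ⟨(k : ℝ) + 1, hk.le, 1 / ((k : ℝ) + 1), by positivity, fun p x _ hx hM => ?_⟩
    by_contra! hlt
    rw [dist_eq_norm] at hx hlt
    exact hno (exists_mem_rnc3_of_lt_infDist2 hcl hbar (by simp) hx hM hlt)
  choose t a u us b q v vs ht htk ha hb hq hu hv hus hvs hqb hq0 hN using hbad
  have hone := tendsto_one_div_add_atTop_nhds_zero_nat (𝕜 := ℝ)
  have ht0 : Tendsto t atTop (𝓝 0) :=
    squeeze_zero (fun k => (ht k).le) (fun k => (htk k).le) hone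
  have hq0' : Tendsto q atTop (𝓝 0) := by
    refine squeeze_zero_norm (fun k => ?_) hone
    rw [le_div_iff₀ (by positivity), mul_comm]
    exact hq k
  have hu0 := tendsto_zero_of_natCast_mul_norm_sq_le (f := fun k => u k - a k) hu
  have hv0 := tendsto_zero_of_natCast_mul_norm_sq_le hv
  have hus0 := tendsto_zero_of_natCast_mul_norm_sq_le hus
  have hvs0 := tendsto_zero_of_natCast_mul_norm_sq_le hvs
  obtain ⟨⟨a', b'⟩, ⟨ha', hb'⟩, φ, hφ, hlim⟩ :=
    ((isCompact_sphere (0 : Es n) 1).prod (isCompact_sphere (0 : Es l) 1)).tendsto_subseq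
      (x := fun k => (a k, b k)) fun k => ⟨by simpa using ha k, by simpa using hb k⟩
  have hφt := hφ.tendsto_atTop
  have hau : Tendsto (u ∘ φ) atTop (𝓝 a') := by
    have h := (hu0.comp hφt).add (continuous_fst.continuousAt.tendsto.comp hlim)
    simpa [Function.comp_def] using h
  have hbb : Tendsto (b ∘ φ) atTop (𝓝 b') := continuous_snd.continuousAt.tendsto.comp hlim
  refine hyp ⟨a', b', by simpa using ha', by simpa using hb', ?_, ?_, ?_⟩
  · refine ⟨fun k => t (φ k) * ‖q (φ k)‖, b ∘ φ,
      fun k => mul_pos (ht _) (norm_pos_iff.2 (hq0 _)), ?_, hbb, fun k => ?_⟩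
    · simpa [Function.comp_def] using (ht0.mul hq0'.norm).comp hφt
    · refine ⟨(xb + t (φ k) • u (φ k), t (φ k) • v (φ k)), ?_⟩
      simp only [mul_smul, Function.comp_apply, ← hqb]
      exact (hN (φ k)).1
  · refine ⟨t ∘ φ, fun k => (q (φ k), u (φ k), v (φ k)), fun k => ht _, ht0.comp hφt,
      (hq0'.comp hφt).prodMk_nhds (hau.prodMk_nhds (hv0.comp hφt)), fun k => ?_⟩
    have := (hN (φ k)).1
    simpa using this
  · exact ⟨t ∘ φ, q ∘ φ, u ∘ φ, v ∘ φ, fun k => -b (φ k), us ∘ φ, vs ∘ φ, fun k => ht _,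
      ht0.comp hφt, hq0'.comp hφt, hau, hv0.comp hφt, fun k => hq0 _, hbb.neg, hus0.comp hφt,
      hvs0.comp hφt, fun k => hN (φ k)⟩
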